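/- arXiv:1009.5538 — 5 statements merged into one kernel-verified Lean document; each statement's English description precedes it below -/
import Mathlib

section
/- There exist absolute constants c1, c2 > 0 such that the following holds. Let X = x_1, …, x_m be any finite sequence of elements of an arbitrary set with decidable equality, and let Y and Z be two complementary subsequences that partition X (i.e., X is an interleaving of Y and Z). Then c1·(Σ_{i=1}^{|Y|} lg(w_Y(i)+2) + Σ_{i=1}^{|Z|} lg(w_Z(i)+2)) ≤ Σ_{i=1}^{|X|} lg(w_X(i)+2) ≤ c2·(Σ_{i=1}^{|Y|} lg(w_Y(i)+2) + Σ_{i=1}^{|Z|} lg(w_Z(i)+2)). In other words, the working-set bound of a sequence is, up to absolute constant factors, the sum of the working-set bounds of the two subsequences, for every interleaving. -/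
/-- The working-set window of position `i` in the sequence `x`: indices `j < i`
such that no occurrence of `x i` lies in `[j, i)`, i.e. indices strictly between
the previous occurrence `ω_X(i)` of `x i` (if any) and `i`. -/
def wsWindow {α : Type*} [DecidableEq α] {m : ℕ} (x : Fin m → α) (i : Fin m) :
    Finset (Fin m) :=
  Finset.univ.filter (fun j => j < i ∧ ∀ k : Fin m, j ≤ k → k < i → x k ≠ x i)

/-- The working-set number `w_X(i)`: number of distinct values in the window. -/
def wsNum {α : Type*} [DecidableEq α] {m : ℕ} (x : Fin m → α) (i : Fin m) : ℕ :=
  ((wsWindow x i).image x).card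

/-- The working-set bound `Σ_i lg (w_X(i) + 2)`. -/
noncomputable def wsBound {α : Type*} [DecidableEq α] {m : ℕ} (x : Fin m → α) : ℝ :=
  ∑ i : Fin m, Real.logb 2 ((wsNum x i : ℝ) + 2)

/-- `W_X(i)`: indices in the working-set window of `i` that are first
occurrences of their value within the window. -/
def wsSet {α : Type*} [DecidableEq α] {m : ℕ} (x : Fin m → α) (i : Fin m) :
    Finset (Fin m) :=
  (wsWindow x i).filter (fun j => ∀ j' ∈ wsWindow x i, j' < j → x j' ≠ x j)

/-- The working-set window of `i` relative to the subsequence of `x` with index set `A`. -/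
def relWindow {α : Type*} [DecidableEq α] {m : ℕ} (x : Fin m → α) (A : Finset (Fin m))
    (i : Fin m) : Finset (Fin m) :=
  A.filter (fun j => j < i ∧ ∀ k ∈ A, j ≤ k → k < i → x k ≠ x i)

/-- The working-set number of `i` relative to the subsequence of `x` with index set `A`. -/
def relNum {α : Type*} [DecidableEq α] {m : ℕ} (x : Fin m → α) (A : Finset (Fin m))
    (i : Fin m) : ℕ :=
  ((relWindow x A i).image x).card

/-- The working-set bound, in natural logarithms, of the subsequence of `x` with index set `A`. -/
noncomputable def relBound {α : Type*} [DecidableEq α] {m : ℕ} (x : Fin m → α)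
    (A : Finset (Fin m)) : ℝ :=
  ∑ i ∈ A, Real.log ((relNum x A i : ℝ) + 2)

section RelativeBounds

variable {α : Type*} [DecidableEq α] {m : ℕ} (x : Fin m → α) (A : Finset (Fin m))

theorem relWindow_comp {p : ℕ} {f : Fin p → Fin m} (hf : StrictMono f) (j : Fin p) :
    relWindow x (Finset.univ.image f) (f j) = (wsWindow (x ∘ f) j).image f := by
  ext i
  simp only [relWindow, wsWindow, Finset.mem_filter, Finset.mem_image, Finset.mem_univ, true_and,
    Function.comp_apply]
  constructor
  · rintro ⟨⟨a, rfl⟩, hlt, h⟩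
    exact ⟨a, ⟨hf.lt_iff_lt.1 hlt, fun k hak hkj =>
      h (f k) ⟨k, rfl⟩ (hf.monotone hak) (hf hkj)⟩, rfl⟩
  · rintro ⟨a, ⟨hlt, h⟩, rfl⟩
    refine ⟨⟨a, rfl⟩, hf hlt, ?_⟩
    rintro _ ⟨k, rfl⟩ hak hkj
    exact h k (hf.le_iff_le.1 hak) (hf.lt_iff_lt.1 hkj)

theorem relNum_comp {p : ℕ} {f : Fin p → Fin m} (hf : StrictMono f) (j : Fin p) :
    relNum x (Finset.univ.image f) (f j) = wsNum (x ∘ f) j := by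
  rw [relNum, relWindow_comp x hf, Finset.image_image, wsNum]

theorem wsBound_comp {p : ℕ} {f : Fin p → Fin m} (hf : StrictMono f) :
    wsBound (x ∘ f) = relBound x (Finset.univ.image f) / Real.log 2 := by
  rw [relBound, Finset.sum_image hf.injective.injOn, wsBound, Finset.sum_div]
  simp only [relNum_comp x hf, Real.logb]

theorem wsBound_eq_relBound_univ : wsBound x = relBound x Finset.univ / Real.log 2 := by
  simpa using wsBound_comp x (strictMono_id (α := Fin m))

theorem relNum_log_nonneg (i : Fin m) : 0 ≤ Real.log ((relNum x A i : ℝ) + 2) :=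
  Real.log_nonneg (by linarith [(relNum x A i).cast_nonneg (α := ℝ)])

/-- The occurrences of `x i` up to `i` that come after its last earlier occurrence in `A`. -/
def occurrencesSince (i : Fin m) : Finset (Fin m) :=
  Finset.univ.filter fun k => k ≤ i ∧ x k = x i ∧ ∀ l ∈ A, k ≤ l → l < i → x l ≠ x i

theorem self_mem_occurrencesSince (i : Fin m) : i ∈ occurrencesSince x A i := by
  simp only [occurrencesSince, Finset.mem_filter, Finset.mem_univ, le_refl, true_and]
  exact fun l _ h h' => absurd h h'.not_ge

theorem pairwiseDisjoint_occurrencesSince :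
    (A : Set (Fin m)).PairwiseDisjoint (occurrencesSince x A) := by
  have key : ∀ i ∈ A, ∀ j, i < j → ∀ k, k ∈ occurrencesSince x A i →
      k ∉ occurrencesSince x A j := by
    intro i hi j hij k hk hk'
    simp only [occurrencesSince, Finset.mem_filter, Finset.mem_univ, true_and] at hk hk'
    exact hk'.2.2 i hi hk.1 hij (hk.2.1.symm.trans hk'.2.1)
  intro i hi j hj hij
  rw [Function.onFun, Finset.disjoint_left]
  rcases lt_or_gt_of_ne hij with h | h
  · exact key i hi j h
  · exact fun k hk hk' => key j hj i h k hk' hk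

theorem relNum_le_sum_occurrencesSince (i : Fin m) :
    relNum x A i ≤ ∑ k ∈ occurrencesSince x A i, relNum x Finset.univ k := by
  refine le_trans (Finset.card_le_card ?_) Finset.card_biUnion_le
  intro v hv
  obtain ⟨j, hj, rfl⟩ := Finset.mem_image.1 hv
  simp only [relWindow, Finset.mem_filter] at hj
  obtain ⟨hjA, hji, hj⟩ := hj
  obtain ⟨k, ⟨hjk, hxk⟩, hmin⟩ : ∃ k, (j < k ∧ x k = x i) ∧ ∀ l, j < l ∧ x l = x i → k ≤ l := by
    have hne : (Finset.univ.filter fun k => j < k ∧ x k = x i).Nonempty :=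
      ⟨i, by simp [hji]⟩
    exact ⟨_, (Finset.mem_filter.1 (Finset.min'_mem _ hne)).2, fun l hl =>
      Finset.min'_le _ l (by simpa using hl)⟩
  refine Finset.mem_biUnion.2 ⟨k, ?_, Finset.mem_image_of_mem _ ?_⟩
  · simp only [occurrencesSince, Finset.mem_filter, Finset.mem_univ, true_and]
    exact ⟨hmin i ⟨hji, rfl⟩, hxk, fun l hl hkl => hj l hl (hjk.le.trans hkl)⟩
  · simp only [relWindow, Finset.mem_filter, Finset.mem_univ, true_and, forall_const]
    refine ⟨hjk, fun l hjl hlk hxl => ?_⟩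
    rcases hjl.eq_or_lt with rfl | h
    · exact hj j hjA le_rfl hji (hxl.trans hxk)
    · exact (hmin l ⟨h, hxl.trans hxk⟩).not_gt hlk

theorem sum_add_two_le_prod {ι : Type*} {s : Finset ι} (hs : s.Nonempty) (f : ι → ℕ) :
    ∑ k ∈ s, f k + 2 ≤ ∏ k ∈ s, (f k + 2) := by
  induction hs using Finset.Nonempty.cons_induction with
  | singleton a => simp
  | cons a s ha hs ih =>
    rw [Finset.sum_cons, Finset.prod_cons]
    refine le_trans ?_ (Nat.mul_le_mul_left (f a + 2) ih)
    ring_nf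
    omega

theorem relBound_le_relBound_univ : relBound x A ≤ relBound x Finset.univ := by
  have hi : ∀ i ∈ A, Real.log ((relNum x A i : ℝ) + 2) ≤
      ∑ k ∈ occurrencesSince x A i, Real.log ((relNum x Finset.univ k : ℝ) + 2) := by
    intro i _
    rw [← Real.log_prod (fun k _ => by positivity)]
    refine Real.log_le_log (by positivity) ?_
    exact_mod_cast (Nat.add_le_add_right (relNum_le_sum_occurrencesSince x A i) 2).trans
      (sum_add_two_le_prod ⟨i, self_mem_occurrencesSince x A i⟩ _)
  refine (Finset.sum_le_sum hi).trans ?_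
  rw [← Finset.sum_biUnion (pairwiseDisjoint_occurrencesSince x A)]
  exact Finset.sum_le_sum_of_subset_of_nonneg (Finset.subset_univ _)
    fun k _ _ => relNum_log_nonneg x _ k

/-- The indices outside `A` lying between `i` and the previous occurrence of `x i` in `A`. -/
def foreignWindow (i : Fin m) : Finset (Fin m) :=
  Aᶜ.filter fun j => j < i ∧ ∀ k ∈ A, j ≤ k → k < i → x k ≠ x i

theorem relNum_univ_le (i : Fin m) :
    relNum x Finset.univ i ≤ relNum x A i + (foreignWindow x A i).card := by
  have hsub : (relWindow x Finset.univ i).image x ⊆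
      (relWindow x A i).image x ∪ (foreignWindow x A i).image x := by
    rw [← Finset.image_union]
    refine Finset.image_subset_image fun j hj => ?_
    simp only [relWindow, foreignWindow, Finset.mem_filter, Finset.mem_univ, true_and,
      Finset.mem_union, Finset.mem_compl, forall_const] at hj ⊢
    by_cases hA : j ∈ A
    · exact Or.inl ⟨hA, hj.1, fun k _ => hj.2 k⟩
    · exact Or.inr ⟨hA, hj.1, fun k _ => hj.2 k⟩
  exact (Finset.card_le_card hsub).trans ((Finset.card_union_le _ _).trans
    (Nat.add_le_add_left Finset.card_image_le _))

theorem sum_inv_sq_le_of_rank_le {ι : Type*} [LinearOrder ι] (s : Finset ι) (u : ι → ℕ)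
    (hu : ∀ i ∈ s, (s.filter (· < i)).card ≤ u i) :
    ∑ i ∈ s, 1 / ((u i : ℝ) + 2) ^ 2 ≤ 1 - 1 / ((s.card : ℝ) + 1) := by
  induction s using Finset.induction_on_max with
  | empty => simp
  | insert a s hmax ih =>
    have ha : a ∉ s := fun h => (hmax a h).false
    have hs := ih fun i hi => by
      refine (Finset.card_le_card ?_).trans (hu i (Finset.mem_insert_of_mem hi))
      exact Finset.filter_subset_filter _ (Finset.subset_insert _ _)
    have hcard : s.card ≤ u a := by
      refine (Finset.card_le_card fun i hi => ?_).trans (hu a (Finset.mem_insert_self _ _))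
      exact Finset.mem_filter.2 ⟨Finset.mem_insert_of_mem hi, hmax i hi⟩
    have hcard' : (s.card : ℝ) ≤ u a := by exact_mod_cast hcard
    rw [Finset.sum_insert ha, Finset.card_insert_of_notMem ha]
    push_cast
    have h1 : 1 / ((u a : ℝ) + 2) ^ 2 ≤ 1 / ((s.card : ℝ) + 2) ^ 2 := by gcongr
    have h2 : 1 / ((s.card : ℝ) + 2) ^ 2 ≤
        1 / ((s.card : ℝ) + 1) - 1 / ((s.card : ℝ) + 1 + 1) := by
      rw [div_sub_div _ _ (by positivity) (by positivity), div_le_div_iff₀ (by positivity)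
        (by positivity)]
      nlinarith [(s.card).cast_nonneg (α := ℝ)]
    linarith

theorem sum_inv_sq_foreignWindow_le (k : Fin m) :
    ∑ i ∈ A with k ∈ foreignWindow x A i, 1 / ((relNum x A i : ℝ) + 2) ^ 2 ≤ 1 := by
  refine (sum_inv_sq_le_of_rank_le _ _ fun i hi => ?_).trans
    (sub_le_self _ (by positivity))
  have hinj : Set.InjOn x
      (({i ∈ A | k ∈ foreignWindow x A i}.filter (· < i) : Finset (Fin m)) : Set (Fin m)) := by
    intro a ha b hb hab
    simp only [foreignWindow, Finset.coe_filter, Finset.mem_filter, Set.mem_ofPred_eq] at ha hb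
    rcases lt_trichotomy a b with h | h | h
    · exact absurd hab (hb.1.2.2.2 a ha.1.1 ha.1.2.2.1.le h)
    · exact h
    · exact absurd hab.symm (ha.1.2.2.2 b hb.1.1 hb.1.2.2.1.le h)
  rw [← Finset.card_image_of_injOn hinj]
  refine Finset.card_le_card (Finset.image_subset_image fun a ha => ?_)
  simp only [foreignWindow, relWindow, Finset.mem_filter] at ha hi ⊢
  exact ⟨ha.1.1, ha.2, fun l hl hal => hi.2.2.2 l hl (ha.1.2.2.1.le.trans hal)⟩

theorem log_add_le (u l : ℕ) :
    Real.log ((u : ℝ) + l + 2) ≤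
      2 * Real.log ((u : ℝ) + 2) + l * (1 / ((u : ℝ) + 2) ^ 2) := by
  have hu : (0 : ℝ) < (u : ℝ) + 2 := by positivity
  have h1 := Real.log_le_sub_one_of_pos (x := ((u : ℝ) + l + 2) / ((u : ℝ) + 2) ^ 2)
    (by positivity)
  rw [Real.log_div (by positivity) (by positivity), Real.log_pow] at h1
  have h2 : ((u : ℝ) + l + 2) / ((u : ℝ) + 2) ^ 2 =
      1 / ((u : ℝ) + 2) + l * (1 / ((u : ℝ) + 2) ^ 2) := by
    field_simp
    ring
  have h3 : 1 / ((u : ℝ) + 2) ≤ 1 := by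
    rw [div_le_one hu]
    linarith [u.cast_nonneg (α := ℝ)]
  push_cast at h1
  linarith

theorem card_mul_log_two_le_relBound : A.card * Real.log 2 ≤ relBound x A := by
  rw [← nsmul_eq_mul]
  refine Finset.card_nsmul_le_sum _ _ _ fun i _ => Real.log_le_log (by norm_num) ?_
  linarith [(relNum x A i).cast_nonneg (α := ℝ)]

theorem sum_relNum_univ_log_le :
    ∑ i ∈ A, Real.log ((relNum x Finset.univ i : ℝ) + 2) ≤
      2 * relBound x A + 2 * relBound x Aᶜ := by
  have hi : ∀ i ∈ A, Real.log ((relNum x Finset.univ i : ℝ) + 2) ≤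
      2 * Real.log ((relNum x A i : ℝ) + 2) +
        (foreignWindow x A i).card * (1 / ((relNum x A i : ℝ) + 2) ^ 2) := by
    intro i _
    refine le_trans (Real.log_le_log (by positivity) ?_) (log_add_le _ _)
    exact_mod_cast Nat.add_le_add_right (relNum_univ_le x A i) 2
  have hcross : ∑ i ∈ A, (foreignWindow x A i).card * (1 / ((relNum x A i : ℝ) + 2) ^ 2) ≤
      (Aᶜ.card : ℝ) := by
    calc ∑ i ∈ A, (foreignWindow x A i).card * (1 / ((relNum x A i : ℝ) + 2) ^ 2)
        = ∑ i ∈ A, ∑ k ∈ foreignWindow x A i, 1 / ((relNum x A i : ℝ) + 2) ^ 2 := by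
          simp only [Finset.sum_const, nsmul_eq_mul]
      _ = ∑ k ∈ Aᶜ, ∑ i ∈ A with k ∈ foreignWindow x A i,
            1 / ((relNum x A i : ℝ) + 2) ^ 2 := by
          refine Finset.sum_comm' fun i k => ?_
          simp only [foreignWindow, Finset.mem_filter]
          tauto
      _ ≤ ∑ k ∈ Aᶜ, (1 : ℝ) := Finset.sum_le_sum fun k _ => sum_inv_sq_foreignWindow_le x A k
      _ = (Aᶜ.card : ℝ) := by simp
  have hsum := Finset.sum_le_sum hi
  rw [Finset.sum_add_distrib, ← Finset.mul_sum] at hsum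
  have hcard := card_mul_log_two_le_relBound x Aᶜ
  have hlog : (1 : ℝ) / 2 ≤ Real.log 2 := by linarith [Real.log_two_gt_d9]
  have hmul := mul_le_mul_of_nonneg_left hlog (Aᶜ.card.cast_nonneg (α := ℝ))
  rw [relBound]
  linarith

theorem relBound_univ_le : relBound x Finset.univ ≤ 4 * (relBound x A + relBound x Aᶜ) := by
  have h1 := sum_relNum_univ_log_le x A
  have h2 := sum_relNum_univ_log_le x Aᶜ
  rw [compl_compl] at h2
  have h3 := Finset.sum_add_sum_compl A fun i => Real.log ((relNum x Finset.univ i : ℝ) + 2)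
  rw [relBound, ← h3]
  linarith

end RelativeBounds

/-- Merging two sequences preserves the working-set bound up to absolute
constant factors (Theorem `th:merge` / `th:mergeappendix`). -/
theorem workingSet_merge_theta :
    ∃ c1 c2 : ℝ, 0 < c1 ∧ 0 < c2 ∧
      ∀ (α : Type*) [DecidableEq α] (m p q : ℕ)
        (x : Fin m → α) (y : Fin p → α) (z : Fin q → α)
        (mY : Fin p → Fin m) (mZ : Fin q → Fin m),
        StrictMono mY → StrictMono mZ →
        (∀ j k, mY j ≠ mZ k) →
        (∀ i : Fin m, (∃ j, mY j = i) ∨ (∃ k, mZ k = i)) →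
        (∀ j, y j = x (mY j)) →
        (∀ k, z k = x (mZ k)) →
        c1 * (wsBound y + wsBound z) ≤ wsBound x ∧
          wsBound x ≤ c2 * (wsBound y + wsBound z) := by
  refine ⟨1 / 2, 4, by norm_num, by norm_num, ?_⟩
  intro α _ m p q x y z mY mZ hY hZ hdisj hcover hy hz
  obtain rfl : y = x ∘ mY := funext hy
  obtain rfl : z = x ∘ mZ := funext hz
  have hcompl : Finset.univ.image mZ = (Finset.univ.image mY)ᶜ := by
    ext i
    simp only [Finset.mem_compl, Finset.mem_image, Finset.mem_univ, true_and]
    constructor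
    · rintro ⟨k, rfl⟩ ⟨j, hj⟩
      exact hdisj j k hj
    · exact (hcover i).resolve_left
  rw [wsBound_comp x hY, wsBound_comp x hZ, wsBound_eq_relBound_univ, hcompl, ← add_div,
    ← mul_div_assoc, ← mul_div_assoc]
  have hlog : 0 ≤ Real.log 2 := Real.log_nonneg (by norm_num)
  constructor
  · refine div_le_div_of_nonneg_right ?_ hlog
    linarith [relBound_le_relBound_univ x (Finset.univ.image mY),
      relBound_le_relBound_univ x (Finset.univ.image mY)ᶜ]
  · exact div_le_div_of_nonneg_right (relBound_univ_le x _) hlog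
end

section
/- There exists an absolute constant c > 0 such that for every finite sequence X = x_1, …, x_m over any set with decidable equality, and every pair of complementary subsequences Y and Z that partition X, one has Σ_{i=1}^{|Y|} lg(w_Y(i)+2) + Σ_{i=1}^{|Z|} lg(w_Z(i)+2) ≤ c·Σ_{i=1}^{|X|} lg(w_X(i)+2). That is, the sum of the working-set bounds of the two subsequences is at most an absolute constant times the working-set bound of the interleaved sequence. -/
theorem Finset.sum_add_two_le_prod_add_two {ι : Type*} {s : Finset ι} (hs : s.Nonempty)
    (f : ι → ℕ) : ∑ i ∈ s, f i + 2 ≤ ∏ i ∈ s, (f i + 2) := by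
  induction hs using Finset.Nonempty.cons_induction with
  | singleton a => simp
  | cons a s ha hs ih =>
    rw [Finset.sum_cons, Finset.prod_cons]
    nlinarith [Nat.zero_le (f a), Nat.zero_le (∑ i ∈ s, f i)]

/-- The occurrences of `x (e j)` in `x` after its previous occurrence in the subsequence `x ∘ e`,
up to and including `e j`. -/
def occurrencesInGap {α : Type*} [DecidableEq α] {m p : ℕ} (x : Fin m → α) (e : Fin p → Fin m)
    (j : Fin p) : Finset (Fin m) :=
  Finset.univ.filter
    (fun i => x i = x (e j) ∧ i ≤ e j ∧ ∀ j' < j, x (e j') = x (e j) → e j' < i)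

section Subsequence

variable {α : Type*} [DecidableEq α] {m p : ℕ} (x : Fin m → α) {e : Fin p → Fin m}

theorem mem_occurrencesInGap_self (he : StrictMono e) (j : Fin p) :
    e j ∈ occurrencesInGap x e j := by
  simp only [occurrencesInGap, Finset.mem_filter, Finset.mem_univ, true_and, le_refl]
  exact fun j' hj' _ => he hj'

theorem pairwise_disjoint_occurrencesInGap :
    Pairwise fun j₁ j₂ => Disjoint (occurrencesInGap x e j₁) (occurrencesInGap x e j₂) := by
  intro j₁ j₂ hne
  refine Finset.disjoint_left.2 fun i h₁ h₂ => ?_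
  simp only [occurrencesInGap, Finset.mem_filter, Finset.mem_univ, true_and] at h₁ h₂
  obtain ⟨hx₁, hle₁, hgap₁⟩ := h₁
  obtain ⟨hx₂, hle₂, hgap₂⟩ := h₂
  rcases hne.lt_or_gt with h | h
  · exact (hgap₂ j₁ h (hx₁.symm.trans hx₂)).not_ge hle₁
  · exact (hgap₁ j₂ h (hx₂.symm.trans hx₁)).not_ge hle₂

theorem image_wsWindow_comp_subset (he : StrictMono e) (j : Fin p) :
    (wsWindow (x ∘ e) j).image (x ∘ e) ⊆
      (occurrencesInGap x e j).biUnion fun i => (wsWindow x i).image x := by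
  intro v hv
  obtain ⟨k, hk, rfl⟩ := Finset.mem_image.1 hv
  simp only [wsWindow, Finset.mem_filter, Finset.mem_univ, true_and, Function.comp_apply] at hk
  obtain ⟨hkj, hk⟩ := hk
  obtain ⟨i, hi, hmin⟩ : ∃ i, (e k ≤ i ∧ x i = x (e j)) ∧
      ∀ i' < i, ¬ (e k ≤ i' ∧ x i' = x (e j)) := by
    obtain ⟨i, hi, hmin⟩ := WellFounded.has_min (wellFounded_lt (α := Fin m))
      {i | e k ≤ i ∧ x i = x (e j)} ⟨e j, (he hkj).le, rfl⟩
    exact ⟨i, hi, fun i' hlt h => hmin i' h hlt⟩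
  refine Finset.mem_biUnion.2 ⟨i, ?_, Finset.mem_image.2 ⟨e k, ?_, rfl⟩⟩
  · simp only [occurrencesInGap, Finset.mem_filter, Finset.mem_univ, true_and]
    refine ⟨hi.2, ?_, fun j' hj' hx => ?_⟩
    · by_contra! h
      exact hmin _ h ⟨(he hkj).le, rfl⟩
    · have : j' < k := by
        by_contra! h
        exact hk j' h hj' hx
      exact (he this).trans_le hi.1
  · simp only [wsWindow, Finset.mem_filter, Finset.mem_univ, true_and]
    refine ⟨hi.1.lt_of_ne ?_, fun k' hk' hlt hx => hmin k' hlt ⟨hk', hx.trans hi.2⟩⟩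
    intro h
    exact hk k le_rfl hkj (h ▸ hi.2)

theorem wsNum_comp_le (he : StrictMono e) (j : Fin p) :
    wsNum (x ∘ e) j ≤ ∑ i ∈ occurrencesInGap x e j, wsNum x i :=
  (Finset.card_le_card (image_wsWindow_comp_subset x he j)).trans Finset.card_biUnion_le

theorem logb_wsNum_comp_le (he : StrictMono e) (j : Fin p) :
    Real.logb 2 ((wsNum (x ∘ e) j : ℝ) + 2) ≤
      ∑ i ∈ occurrencesInGap x e j, Real.logb 2 ((wsNum x i : ℝ) + 2) := by
  rw [← Real.logb_prod _ _ fun i _ => by positivity]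
  refine Real.logb_le_logb_of_le one_lt_two (by positivity) ?_
  have h := (Nat.add_le_add_right (wsNum_comp_le x he j) 2).trans
    (Finset.sum_add_two_le_prod_add_two ⟨e j, mem_occurrencesInGap_self x he j⟩ (wsNum x))
  exact_mod_cast h

/-- The working-set bound of a subsequence is at most that of the whole sequence. -/
theorem wsBound_comp_le (he : StrictMono e) : wsBound (x ∘ e) ≤ wsBound x := by
  unfold wsBound
  refine (Finset.sum_le_sum fun j _ => logb_wsNum_comp_le x he j).trans ?_
  rw [← Finset.sum_biUnion fun j₁ _ j₂ _ h => pairwise_disjoint_occurrencesInGap x h]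
  refine Finset.sum_le_sum_of_subset_of_nonneg (Finset.subset_univ _) fun i _ _ => ?_
  exact Real.logb_nonneg one_lt_two (by linarith [Nat.cast_nonneg (α := ℝ) (wsNum x i)])

end Subsequence

/-- The sum of the working-set bounds of two complementary subsequences is at
most an absolute constant times the working-set bound of the interleaving. -/
theorem workingSet_merge_lower :
    ∃ c : ℝ, 0 < c ∧
      ∀ (α : Type*) [DecidableEq α] (m p q : ℕ)
        (x : Fin m → α) (y : Fin p → α) (z : Fin q → α)
        (mY : Fin p → Fin m) (mZ : Fin q → Fin m),
        StrictMono mY → StrictMono mZ →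
        (∀ j k, mY j ≠ mZ k) →
        (∀ i : Fin m, (∃ j, mY j = i) ∨ (∃ k, mZ k = i)) →
        (∀ j, y j = x (mY j)) →
        (∀ k, z k = x (mZ k)) →
        wsBound y + wsBound z ≤ c * wsBound x := by
  refine ⟨2, two_pos, ?_⟩
  intro α _ m p q x y z mY mZ hY hZ _ _ hy hz
  obtain rfl : y = x ∘ mY := funext hy
  obtain rfl : z = x ∘ mZ := funext hz
  linarith [wsBound_comp_le x hY, wsBound_comp_le x hZ]
end

section
/- Let X = x_1, …, x_m be a finite sequence over a set with decidable equality, and let Y and Z be complementary subsequences partitioning X such that no value occurs both in Y and in Z (the value sets of Y and Z are disjoint). Then for every index j with 1 ≤ j ≤ |Y|, the working-set number of the corresponding position in X dominates that in Y: w_X(m_Y(j)) ≥ w_Y(j). Consequently (by symmetry applied also to Z), Σ_{i=1}^{|X|} lg(w_X(i)+2) ≥ Σ_{i=1}^{|Y|} lg(w_Y(i)+2) + Σ_{i=1}^{|Z|} lg(w_Z(i)+2). -/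
/-- Working-set numbers do not increase on passing to a subsequence that retains every occurrence
of the values it contains. -/
theorem wsNum_le_wsNum_of_strictMono {α : Type*} [DecidableEq α] {m p : ℕ}
    {x : Fin m → α} {y : Fin p → α} {f : Fin p → Fin m} (hf : StrictMono f)
    (hy : ∀ j, y j = x (f j)) (hocc : ∀ i j, x i = y j → ∃ j', f j' = i) (j : Fin p) :
    wsNum y j ≤ wsNum x (f j) := by
  refine Finset.card_le_card fun a ha => ?_
  simp only [wsWindow, Finset.mem_image, Finset.mem_filter, Finset.mem_univ, true_and] at ha ⊢
  obtain ⟨i, ⟨hij, hne⟩, rfl⟩ := ha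
  refine ⟨f i, ⟨hf hij, fun k hik hkj hk => ?_⟩, (hy i).symm⟩
  obtain ⟨k', rfl⟩ := hocc k j (hk.trans (hy j).symm)
  exact hne k' (hf.le_iff_le.1 hik) (hf.lt_iff_lt.1 hkj) (by rw [hy, hy, hk])

/-- If the value sets of the two complementary subsequences `Y` and `Z` are
disjoint, then the working-set number in `X` dominates that in `Y` pointwise,
and consequently the working-set bound of `X` dominates the sum of the
working-set bounds of `Y` and `Z`. -/
theorem workingSet_merge_disjoint_values
    {α : Type*} [DecidableEq α] {m p q : ℕ}
    (x : Fin m → α) (y : Fin p → α) (z : Fin q → α)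
    (mY : Fin p → Fin m) (mZ : Fin q → Fin m)
    (hmY : StrictMono mY) (hmZ : StrictMono mZ)
    (hdisj : ∀ j k, mY j ≠ mZ k)
    (hcover : ∀ i : Fin m, (∃ j, mY j = i) ∨ (∃ k, mZ k = i))
    (hy : ∀ j, y j = x (mY j))
    (hz : ∀ k, z k = x (mZ k))
    (hvals : ∀ j k, y j ≠ z k) :
    (∀ j : Fin p, wsNum y j ≤ wsNum x (mY j)) ∧
      wsBound y + wsBound z ≤ wsBound x := by
  have hY : ∀ j, wsNum y j ≤ wsNum x (mY j) :=
    wsNum_le_wsNum_of_strictMono hmY hy fun i j hij => by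
      refine (hcover i).resolve_right ?_
      rintro ⟨k, rfl⟩
      exact hvals j k (by rw [hz, hij])
  have hZ : ∀ k, wsNum z k ≤ wsNum x (mZ k) :=
    wsNum_le_wsNum_of_strictMono hmZ hz fun i k hik => by
      refine (hcover i).resolve_left ?_
      rintro ⟨j, rfl⟩
      exact hvals j k (by rw [hy, hik])
  have hlog {a b : ℕ} (h : a ≤ b) : Real.logb 2 ((a : ℝ) + 2) ≤ Real.logb 2 ((b : ℝ) + 2) :=
    Real.logb_le_logb_of_le one_lt_two (by positivity) (by gcongr)
  have hbij : Function.Bijective (Sum.elim mY mZ) :=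
    ⟨hmY.injective.sumElim hmZ.injective hdisj, fun i => by simpa using hcover i⟩
  refine ⟨hY, ?_⟩
  calc wsBound y + wsBound z
      ≤ ∑ j, Real.logb 2 ((wsNum x (mY j) : ℝ) + 2) +
          ∑ k, Real.logb 2 ((wsNum x (mZ k) : ℝ) + 2) :=
        add_le_add (Finset.sum_le_sum fun j _ => hlog (hY j))
          (Finset.sum_le_sum fun k _ => hlog (hZ k))
    _ = wsBound x := by
        rw [wsBound, ← hbij.sum_comp, Fintype.sum_sum_type]
        rfl
end

section
/- Let X = x_1, …, x_m be a finite sequence over a set with decidable equality, let 1 ≤ i ≤ m, and let W_X(i) be the set of indices j in the working-set window of position i (i.e., ω_X(i) < j < i if ω_X(i) exists, else 1 ≤ j < i) such that x_j is the first occurrence of its value within that window. Then |W_X(i)| = w_X(i), and for every k with 1 ≤ k ≤ |W_X(i)|, the k-th largest index j in W_X(i) satisfies w_X(j) ≥ w_X(i) − k. -/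
theorem mem_wsWindow_of_le {α : Type*} [DecidableEq α] {m : ℕ} {x : Fin m → α} {i j k : Fin m}
    (hj : j ∈ wsWindow x i) (hjk : j ≤ k) (hki : k < i) : k ∈ wsWindow x i := by
  simp only [wsWindow, Finset.mem_filter, Finset.mem_univ, true_and] at hj ⊢
  exact ⟨hki, fun l hkl hli => hj.2 l (hjk.trans hkl) hli⟩

theorem lt_of_mem_wsWindow {α : Type*} [DecidableEq α] {m : ℕ} {x : Fin m → α} {i j : Fin m}
    (hj : j ∈ wsWindow x i) : j < i :=
  (Finset.mem_filter.1 hj).2.1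

theorem injOn_wsSet {α : Type*} [DecidableEq α] {m : ℕ} (x : Fin m → α) (i : Fin m) :
    Set.InjOn x (wsSet x i : Set (Fin m)) := by
  intro a ha b hb hab
  obtain ⟨haw, ha⟩ := Finset.mem_filter.1 (Finset.mem_coe.1 ha)
  obtain ⟨hbw, hb⟩ := Finset.mem_filter.1 (Finset.mem_coe.1 hb)
  rcases lt_trichotomy a b with h | h | h
  · exact absurd hab (hb a haw h)
  · exact h
  · exact absurd hab.symm (ha b hbw h)

theorem image_wsSet {α : Type*} [DecidableEq α] {m : ℕ} (x : Fin m → α) (i : Fin m) :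
    (wsSet x i).image x = (wsWindow x i).image x := by
  refine (Finset.image_subset_image (Finset.filter_subset _ _)).antisymm ?_
  intro y hy
  obtain ⟨j, hj, rfl⟩ := Finset.mem_image.1 hy
  obtain ⟨k, hk, hmin⟩ := ((wsWindow x i).filter (fun l => x l = x j)).exists_min_image id
    ⟨j, Finset.mem_filter.2 ⟨hj, rfl⟩⟩
  obtain ⟨hkw, hkj⟩ := Finset.mem_filter.1 hk
  refine Finset.mem_image.2 ⟨k, Finset.mem_filter.2 ⟨hkw, fun l hl hlk hxl => ?_⟩, hkj⟩
  exact (hmin l (Finset.mem_filter.2 ⟨hl, hxl.trans hkj⟩)).not_gt hlk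

theorem card_wsSet {α : Type*} [DecidableEq α] {m : ℕ} (x : Fin m → α) (i : Fin m) :
    (wsSet x i).card = wsNum x i := by
  rw [wsNum, ← image_wsSet, Finset.card_image_of_injOn (injOn_wsSet x i)]

/-- Earlier members of `W_X(i)` lie in the working-set window of each later member. -/
theorem mem_wsWindow_of_lt_of_mem_wsSet {α : Type*} [DecidableEq α] {m : ℕ} {x : Fin m → α}
    {i j l : Fin m} (hj : j ∈ wsSet x i) (hl : l ∈ wsSet x i) (hlj : l < j) :
    l ∈ wsWindow x j := by
  obtain ⟨hjw, hfirst⟩ := Finset.mem_filter.1 hj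
  have hlw := (Finset.mem_filter.1 hl).1
  refine Finset.mem_filter.2 ⟨Finset.mem_univ _, hlj, fun k hlk hkj => ?_⟩
  exact hfirst k (mem_wsWindow_of_le hlw hlk (hkj.trans (lt_of_mem_wsWindow hjw))) hkj

theorem card_filter_not_le_wsSet_le_wsNum {α : Type*} [DecidableEq α] {m : ℕ} {x : Fin m → α}
    {i j : Fin m} (hj : j ∈ wsSet x i) :
    ((wsSet x i).filter (fun l => ¬ j ≤ l)).card ≤ wsNum x j := by
  have hinj : Set.InjOn x ((wsSet x i).filter (fun l => ¬ j ≤ l) : Set (Fin m)) :=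
    (injOn_wsSet x i).mono (Finset.coe_subset.2 (Finset.filter_subset _ _))
  rw [wsNum, ← Finset.card_image_of_injOn hinj]
  refine Finset.card_le_card (Finset.image_subset_image fun l hl => ?_)
  obtain ⟨hl, hlj⟩ := Finset.mem_filter.1 hl
  exact mem_wsWindow_of_lt_of_mem_wsSet hj hl (not_le.1 hlj)

/-- `W_X(i)` has exactly `w_X(i)` elements, and for each `j ∈ W_X(i)`, if `j`
is the `k`-th largest index of `W_X(i)` (so `k = |{j' ∈ W_X(i) | j ≤ j'}|`),
then `w_X(j) ≥ w_X(i) - k`. -/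
theorem wsSet_card_and_kth_largest
    {α : Type*} [DecidableEq α] {m : ℕ} (x : Fin m → α) (i : Fin m) :
    (wsSet x i).card = wsNum x i ∧
      ∀ j ∈ wsSet x i,
        (wsNum x i : ℤ) - ((wsSet x i).filter (fun j' => j ≤ j')).card ≤
          (wsNum x j : ℤ) := by
  refine ⟨card_wsSet x i, fun j hj => ?_⟩
  have hlt := card_filter_not_le_wsSet_le_wsNum hj
  have hsplit := (wsSet x i).card_filter_add_card_filter_not (fun l => j ≤ l)
  rw [card_wsSet] at hsplit
  omega
end

section
/- The working-set bound is asymptotically equivalent to the unified bound: there exist absolute constants c1, c2 > 0 such that for every finite sequence X = x_1, …, x_m of integers (elements identified with their ranks) and every integer f (the finger), c1·Σ_{i=1}^m lg min{|x_i − f|+2, m/q(x_i)+1, w_X(i)+2} ≤ Σ_{i=1}^m lg(w_X(i)+2) ≤ c2·Σ_{i=1}^m lg min{|x_i − f|+2, m/q(x_i)+1, w_X(i)+2}, where q(a) is the number of indices i with x_i = a. -/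
/-- `q(a)`: the number of indices `i` with `x i = a`. -/
def freq {α : Type*} [DecidableEq α] {m : ℕ} (x : Fin m → α) (a : α) : ℕ :=
  (Finset.univ.filter (fun i => x i = a)).card

/-- The unified bound `Σ_i lg min{|x_i − f| + 2, m/q(x_i) + 1, w_X(i) + 2}`
for integer sequences with respect to the finger `f`. -/
noncomputable def unifiedBound {m : ℕ} (x : Fin m → ℤ) (f : ℤ) : ℝ :=
  ∑ i : Fin m, Real.logb 2
    (min (min (((x i - f).natAbs : ℝ) + 2)
              ((m : ℝ) / (freq x (x i) : ℝ) + 1))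
         ((wsNum x i : ℝ) + 2))

section WorkingSet

variable {α : Type*} [DecidableEq α] {m : ℕ}

theorem disjoint_wsWindow {x : Fin m → α} {i j : Fin m} (hij : i ≠ j) (hx : x i = x j) :
    Disjoint (wsWindow x i) (wsWindow x j) := by
  rw [Finset.disjoint_left]
  intro k hki hkj
  simp only [wsWindow, Finset.mem_filter, Finset.mem_univ, true_and] at hki hkj
  rcases lt_or_gt_of_ne hij with h | h
  · exact hkj.2 i hki.1.le h hx
  · exact hki.2 j hkj.1.le h hx.symm

theorem sum_wsNum_fiber_le (x : Fin m → α) (a : α) :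
    ∑ i with x i = a, wsNum x i ≤ m := by
  calc ∑ i with x i = a, wsNum x i
      ≤ ∑ i with x i = a, (wsWindow x i).card :=
        Finset.sum_le_sum fun i _ => Finset.card_image_le
    _ = ((Finset.univ.filter fun i => x i = a).biUnion (wsWindow x)).card := by
        rw [Finset.card_biUnion]
        intro i hi j hj hij
        rw [Finset.mem_coe, Finset.mem_filter] at hi hj
        exact disjoint_wsWindow hij (hi.2.trans hj.2.symm)
    _ ≤ m := (Finset.card_le_univ _).trans_eq (Fintype.card_fin m)

theorem freq_le (x : Fin m → α) (a : α) : freq x a ≤ m := by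
  simpa [freq] using Finset.card_le_univ (Finset.univ.filter fun i => x i = a)

theorem freq_pos (x : Fin m → α) (i : Fin m) : 0 < freq x (x i) :=
  Finset.card_pos.mpr ⟨i, by simp⟩

theorem sum_freq_image (x : Fin m → α) : ∑ a ∈ Finset.univ.image x, freq x a = m := by
  simpa [freq] using (Finset.card_eq_sum_card_image x Finset.univ).symm

theorem sum_wsNum_add_two_fiber_le (x : Fin m → α) (a : α) :
    ∑ i with x i = a, ((wsNum x i : ℝ) + 2) ≤ 3 * m := by
  have h₁ : (∑ i with x i = a, (wsNum x i : ℝ)) ≤ m := by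
    exact_mod_cast sum_wsNum_fiber_le x a
  have h₂ : ((Finset.univ.filter fun i => x i = a).card : ℝ) ≤ m := by
    exact_mod_cast freq_le x a
  rw [Finset.sum_add_distrib, Finset.sum_const, nsmul_eq_mul]
  linarith

/-- Weighting each access by a function of the accessed value costs at most `3 m` times the
total weight of the values that occur. -/
theorem sum_wsNum_add_two_mul_le (x : Fin m → α) {g : α → ℝ} (hg : ∀ a, 0 ≤ g a) :
    ∑ i, ((wsNum x i : ℝ) + 2) * g (x i) ≤ 3 * m * ∑ a ∈ Finset.univ.image x, g a := by
  rw [← Finset.sum_fiberwise_of_maps_to (t := Finset.univ.image x) (g := x)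
    (fun i _ => Finset.mem_image_of_mem x (Finset.mem_univ i)), Finset.mul_sum]
  refine Finset.sum_le_sum fun a _ => ?_
  calc ∑ i with x i = a, ((wsNum x i : ℝ) + 2) * g (x i)
      = (∑ i with x i = a, ((wsNum x i : ℝ) + 2)) * g a := by
        rw [Finset.sum_mul]
        refine Finset.sum_congr rfl fun i hi => ?_
        rw [(Finset.mem_filter.mp hi).2]
    _ ≤ 3 * m * g a := mul_le_mul_of_nonneg_right (sum_wsNum_add_two_fiber_le x a) (hg a)

theorem sum_inv_frequency_sq_le_one (x : Fin m → α) :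
    ∑ a ∈ Finset.univ.image x, (((m : ℝ) / freq x a + 1) ^ 2)⁻¹ ≤ 1 := by
  calc ∑ a ∈ Finset.univ.image x, (((m : ℝ) / freq x a + 1) ^ 2)⁻¹
      ≤ ∑ a ∈ Finset.univ.image x, (freq x a : ℝ) / m := by
        refine Finset.sum_le_sum fun a ha => ?_
        obtain ⟨i, -, rfl⟩ := Finset.mem_image.mp ha
        have hq : (0 : ℝ) < freq x (x i) := by exact_mod_cast freq_pos x i
        have hm : (0 : ℝ) < m := by exact_mod_cast i.pos
        have hr : 0 < (m : ℝ) / freq x (x i) := div_pos hm hq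
        rw [← inv_div (m : ℝ)]
        exact inv_anti₀ hr (by nlinarith)
    _ = ((∑ a ∈ Finset.univ.image x, freq x a : ℕ) : ℝ) / m := by
        rw [Nat.cast_sum, Finset.sum_div]
    _ ≤ 1 := by rw [sum_freq_image]; exact div_self_le_one _

end WorkingSet

theorem summable_inv_natAbs_add_two_sq :
    Summable fun n : ℤ => (((n.natAbs : ℝ) + 2) ^ 2)⁻¹ := by
  have h : Summable fun n : ℕ => (((n : ℝ) + 2) ^ 2)⁻¹ := by
    simpa using (summable_nat_add_iff 2).mpr (Real.summable_nat_pow_inv.mpr one_lt_two)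
  exact Summable.of_nat_of_neg (by simpa using h) (by simpa using h)

theorem sum_inv_dist_sq_le_tsum (s : Finset ℤ) (f : ℤ) :
    ∑ a ∈ s, ((((a - f).natAbs : ℝ) + 2) ^ 2)⁻¹
      ≤ ∑' n : ℤ, (((n.natAbs : ℝ) + 2) ^ 2)⁻¹ := by
  rw [← (Equiv.subRight f).tsum_eq fun n : ℤ => (((n.natAbs : ℝ) + 2) ^ 2)⁻¹]
  exact ((Equiv.subRight f).summable_iff.mpr summable_inv_natAbs_add_two_sq).sum_le_tsum s
    fun _ _ => by positivity

theorem logb_two_le_two_mul {t : ℝ} (ht : 0 < t) : Real.logb 2 t ≤ 2 * t := by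
  rw [Real.logb, div_le_iff₀ (Real.log_pos one_lt_two)]
  nlinarith [Real.log_le_sub_one_of_pos ht, Real.log_two_gt_d9]

theorem logb_two_le_two_mul_logb_min {c w : ℝ} (hc : 0 < c) (hw : 1 ≤ w) :
    Real.logb 2 w ≤ 2 * Real.logb 2 (min c w) + 2 * (w * (c ^ 2)⁻¹) := by
  have hw₀ : 0 < w := by linarith
  rcases le_total c w with h | h
  · have h₁ := logb_two_le_two_mul (t := w * (c ^ 2)⁻¹) (by positivity)
    rw [Real.logb_mul (by positivity) (by positivity), Real.logb_inv, Real.logb_pow] at h₁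
    rw [min_eq_left h]
    push_cast at h₁
    linarith
  · rw [min_eq_right h]
    have h₁ : 0 ≤ Real.logb 2 w := Real.logb_nonneg one_lt_two hw
    have h₂ : 0 ≤ w * (c ^ 2)⁻¹ := by positivity
    linarith

theorem inv_min_sq_le_add (a b : ℝ) :
    ((min a b) ^ 2)⁻¹ ≤ (a ^ 2)⁻¹ + (b ^ 2)⁻¹ := by
  have ha : 0 ≤ (a ^ 2)⁻¹ := by positivity
  have hb : 0 ≤ (b ^ 2)⁻¹ := by positivity
  rcases le_total a b with h | h
  · rw [min_eq_left h]; linarith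
  · rw [min_eq_right h]; linarith

section UnifiedBound

variable {m : ℕ} (x : Fin m → ℤ) (f : ℤ)

theorem two_le_min_dist_frequency (i : Fin m) :
    2 ≤ min (((x i - f).natAbs : ℝ) + 2) ((m : ℝ) / (freq x (x i) : ℝ) + 1) := by
  have hq : (0 : ℝ) < freq x (x i) := by exact_mod_cast freq_pos x i
  have hm : (freq x (x i) : ℝ) ≤ m := by exact_mod_cast freq_le x (x i)
  have hr : 1 ≤ (m : ℝ) / freq x (x i) := (one_le_div hq).mpr hm
  exact le_min (le_add_of_nonneg_left (Nat.cast_nonneg _)) (by linarith)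

theorem card_le_unifiedBound : (m : ℝ) ≤ unifiedBound x f := by
  have h : ∑ _i : Fin m, (1 : ℝ) ≤ unifiedBound x f := by
    refine Finset.sum_le_sum fun i _ => ?_
    have h₂ := le_min (two_le_min_dist_frequency x f i)
      (le_add_of_nonneg_left (Nat.cast_nonneg (wsNum x i)) : (2 : ℝ) ≤ _)
    rw [Real.le_logb_iff_rpow_le one_lt_two (by linarith)]
    simpa using h₂
  simpa using h

theorem unifiedBound_le_wsBound : unifiedBound x f ≤ wsBound x := by
  refine Finset.sum_le_sum fun i _ => ?_
  have h₁ := two_le_min_dist_frequency x f i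
  exact Real.logb_le_logb_of_le one_lt_two
    (lt_min (by linarith) (by positivity)) (min_le_right _ _)

theorem wsBound_le_mul_unifiedBound :
    wsBound x ≤
      (2 + 6 * ((∑' n : ℤ, (((n.natAbs : ℝ) + 2) ^ 2)⁻¹) + 1)) * unifiedBound x f := by
  set S := ∑' n : ℤ, (((n.natAbs : ℝ) + 2) ^ 2)⁻¹
  have hS₀ : 0 ≤ S := tsum_nonneg fun _ => by positivity
  let g : ℤ → ℝ := fun a =>
    ((((a - f).natAbs : ℝ) + 2) ^ 2)⁻¹ + (((m : ℝ) / freq x a + 1) ^ 2)⁻¹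
  have hg : ∀ a, 0 ≤ g a := fun a => by positivity
  have hgS : ∑ a ∈ Finset.univ.image x, g a ≤ S + 1 := by
    rw [Finset.sum_add_distrib]
    exact add_le_add (sum_inv_dist_sq_le_tsum _ f) (sum_inv_frequency_sq_le_one x)
  calc wsBound x
      ≤ 2 * unifiedBound x f + 2 * ∑ i, ((wsNum x i : ℝ) + 2) * g (x i) := by
        rw [wsBound, unifiedBound, Finset.mul_sum, Finset.mul_sum, ← Finset.sum_add_distrib]
        refine Finset.sum_le_sum fun i _ => ?_
        have hw : (2 : ℝ) ≤ (wsNum x i : ℝ) + 2 :=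
          le_add_of_nonneg_left (Nat.cast_nonneg _)
        have hc := two_le_min_dist_frequency x f i
        refine (logb_two_le_two_mul_logb_min (by linarith) (by linarith)).trans ?_
        gcongr
        exact inv_min_sq_le_add _ _
    _ ≤ 2 * unifiedBound x f + 2 * (3 * m * (S + 1)) := by
        gcongr
        refine (sum_wsNum_add_two_mul_le x hg).trans ?_
        gcongr
    _ ≤ 2 * unifiedBound x f + 2 * (3 * unifiedBound x f * (S + 1)) := by
        gcongr
        exact card_le_unifiedBound x f
    _ = (2 + 6 * (S + 1)) * unifiedBound x f := by ring

end UnifiedBound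

/-- The working-set bound is asymptotically equivalent to the unified bound. -/
theorem workingSet_equiv_unified :
    ∃ c1 c2 : ℝ, 0 < c1 ∧ 0 < c2 ∧
      ∀ (m : ℕ) (x : Fin m → ℤ) (f : ℤ),
        c1 * unifiedBound x f ≤ wsBound x ∧
          wsBound x ≤ c2 * unifiedBound x f := by
  refine ⟨1, 2 + 6 * ((∑' n : ℤ, (((n.natAbs : ℝ) + 2) ^ 2)⁻¹) + 1), one_pos, ?_,
    fun m x f => ⟨?_, wsBound_le_mul_unifiedBound x f⟩⟩
  · have : 0 ≤ ∑' n : ℤ, (((n.natAbs : ℝ) + 2) ^ 2)⁻¹ := tsum_nonneg fun _ => by positivity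
    positivity
  · rw [one_mul]
    exact unifiedBound_le_wsBound x f
end
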